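/- arXiv:1107.0849 — 2 statements merged into one kernel-verified Lean document; each statement's English description precedes it below -/
import Mathlib

section
/- Let n ≥ 2 be a natural number and let β₁, …, βₙ be real numbers with βₖ ∈ (0,√2) for all k, β₁ + ⋯ + βₙ = √2, and F₂(β_i) = F₂(β_j) for all i, j (the Lagrange stationarity condition). Then βₖ = √2/n for every k. -/
open Real

/-- F₂(β) = 4β·log β + 2/β + 2(1−β)·log|1−β| − 2(1+β)·log(1+β). -/
noncomputable def F2 (β : ℝ) : ℝ :=
  4 * β * Real.log β + 2 / β + 2 * (1 - β) * Real.log |1 - β|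
    - 2 * (1 + β) * Real.log (1 + β)

theorem F2_eq_mul_log : F2 = fun β : ℝ => 4 * (β * Real.log β) + 2 * β⁻¹
    + 2 * ((1 - β) * Real.log (1 - β)) - 2 * ((1 + β) * Real.log (1 + β)) := by
  funext β
  simp only [F2, Real.log_abs]
  ring

theorem hasDerivAt_F2 {x : ℝ} (hx : 0 < x) (hx1 : x ≠ 1) :
    HasDerivAt F2 (4 * Real.log x - 2 / x ^ 2 - 2 * Real.log (1 - x) - 2 * Real.log (1 + x)) x := by
  rw [F2_eq_mul_log]
  have hsub : HasDerivAt (fun y : ℝ => 1 - y) (-1) x := by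
    simpa using (hasDerivAt_id x).const_sub 1
  have hadd : HasDerivAt (fun y : ℝ => 1 + y) 1 x := by
    simpa using (hasDerivAt_id x).const_add 1
  have h1 := (Real.hasDerivAt_mul_log hx.ne').const_mul 4
  have h2 := (hasDerivAt_inv hx.ne').const_mul 2
  have h3 := ((Real.hasDerivAt_mul_log (sub_ne_zero.2 hx1.symm)).comp x hsub).const_mul 2
  have h4 := ((Real.hasDerivAt_mul_log (by positivity : (1 + x) ≠ 0)).comp x hadd).const_mul 2
  refine (((h1.add h2).add h3).sub h4).congr_deriv ?_
  ring

theorem continuousOn_F2 : ContinuousOn F2 (Set.Ioi 0) := by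
  rw [F2_eq_mul_log]
  have h1 : Continuous fun β : ℝ => β * Real.log β := Real.continuous_mul_log
  have h2 : Continuous fun β : ℝ => (1 - β) * Real.log (1 - β) :=
    h1.comp (continuous_const.sub continuous_id)
  have h3 : Continuous fun β : ℝ => (1 + β) * Real.log (1 + β) :=
    h1.comp (continuous_const.add continuous_id)
  have h4 : ContinuousOn (fun β : ℝ => 2 * β⁻¹) (Set.Ioi 0) :=
    continuousOn_const.mul (continuousOn_id.inv₀ fun x hx => ne_of_gt hx)
  exact (((h1.const_mul 4).continuousOn.add h4).add (h2.const_mul 2).continuousOn).sub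
    (h3.const_mul 2).continuousOn

theorem strictAntiOn_F2 : StrictAntiOn F2 (Set.Ioc 0 (21 / 25)) := by
  refine strictAntiOn_of_deriv_neg (convex_Ioc _ _)
    (continuousOn_F2.mono fun x hx => hx.1) fun x hx => ?_
  rw [interior_Ioc] at hx
  obtain ⟨h0, h1⟩ := hx
  rw [(hasDerivAt_F2 h0 (by linarith)).deriv]
  have hx2 : x ^ 2 < 0.7056 := by nlinarith
  have hpos : 0 < 1 - x ^ 2 := by linarith
  have hlog : Real.log (x ^ 2 / (1 - x ^ 2)) = 2 * Real.log x - (Real.log (1 - x) + Real.log (1 + x)) := by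
    rw [Real.log_div (by positivity) hpos.ne', Real.log_pow,
      ← Real.log_mul (by linarith) (by linarith)]
    ring_nf
  have hle := Real.log_le_sub_one_of_pos (x := x ^ 2 / (1 - x ^ 2)) (by positivity)
  have hkey : x ^ 2 / (1 - x ^ 2) - 1 < 1 / x ^ 2 := by
    rw [div_sub_one hpos.ne', div_lt_div_iff₀ hpos (by positivity)]
    nlinarith [sq_nonneg x]
  have : 2 / x ^ 2 = 2 * (1 / x ^ 2) := by ring
  linarith

theorem strictMonoOn_F2 : StrictMonoOn F2 (Set.Ici 1) := by
  refine strictMonoOn_of_deriv_pos (convex_Ici _)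
    (continuousOn_F2.mono (Set.Ici_subset_Ioi.2 one_pos)) fun x hx => ?_
  rw [interior_Ici] at hx
  have hx1 : 1 < x := hx
  have h0 : 0 < x := by linarith
  rw [(hasDerivAt_F2 h0 hx1.ne').deriv]
  have hpos : 0 < x ^ 2 - 1 := by nlinarith
  have hlog : Real.log ((x ^ 2 - 1) / x ^ 2) = Real.log (1 - x) + Real.log (1 + x) - 2 * Real.log x := by
    rw [Real.log_div hpos.ne' (by positivity), Real.log_pow,
      ← Real.log_mul (by linarith) (by linarith), ← Real.log_neg_eq_log]
    ring_nf
  have hlt := Real.log_lt_sub_one_of_pos (x := (x ^ 2 - 1) / x ^ 2) (by positivity)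
    (by rw [ne_eq, div_eq_one_iff_eq (by positivity)]; linarith)
  have hkey : (x ^ 2 - 1) / x ^ 2 - 1 = -(1 / x ^ 2) := by
    field_simp
    ring
  have : 2 / x ^ 2 = 2 * (1 / x ^ 2) := by ring
  linarith

theorem F2_pos : 0 < F2 (23 / 40) := by
  have l2 := Real.log_two_lt_d9
  have e1 : Real.log (23 / 40) = -(Real.log 2 + Real.log (20 / 23)) := by
    rw [← Real.log_mul (by norm_num) (by norm_num), ← Real.log_inv]
    norm_num
  have e2 : Real.log (17 / 40) = -(Real.log 2 + Real.log (20 / 17)) := by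
    rw [← Real.log_mul (by norm_num) (by norm_num), ← Real.log_inv]
    norm_num
  have e3 : 3 * Real.log (63 / 40) = 2 * Real.log 2 + Real.log ((63 / 40) ^ 3 / 4) := by
    rw [Real.log_div (x := (63 / 40) ^ 3) (by norm_num) (by norm_num), Real.log_pow,
      show (4 : ℝ) = 2 ^ 2 by norm_num, Real.log_pow]
    push_cast
    ring
  have b1 := Real.log_le_sub_one_of_pos (x := 20 / 23) (by norm_num)
  have b2 := Real.log_le_sub_one_of_pos (x := 20 / 17) (by norm_num)
  have b3 := Real.log_le_sub_one_of_pos (x := (63 / 40) ^ 3 / 4) (by norm_num)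
  rw [F2, Real.log_abs, show (1 - 23 / 40 : ℝ) = 17 / 40 by norm_num,
    show (1 + 23 / 40 : ℝ) = 63 / 40 by norm_num, e1, e2]
  norm_num at b1 b2 b3 e3 ⊢
  linarith

theorem F2_sqrt_two_neg : F2 (√2) < 0 := by
  have hs : √2 ^ 2 = 2 := Real.sq_sqrt (by norm_num)
  have hs0 : 0 ≤ √2 := Real.sqrt_nonneg 2
  have hs1 : 1.414 < √2 := Real.lt_sqrt_of_sq_lt (by norm_num)
  have hs2 : √2 < 1.4143 := (Real.sqrt_lt' (by norm_num)).2 (by norm_num)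
  have l2 := Real.log_two_lt_d9
  have l2' := Real.log_two_gt_d9
  have e1 : Real.log (1 - √2) = -Real.log (1 + √2) := by
    rw [← Real.log_inv, ← Real.log_neg_eq_log]
    congr 1
    apply eq_inv_of_mul_eq_one_left
    nlinarith
  have e2 : 2 * Real.log (1 + √2) = 3 * Real.log 2 - Real.log (8 / (1 + √2) ^ 2) := by
    rw [Real.log_div (by norm_num) (by positivity), Real.log_pow,
      show (8 : ℝ) = 2 ^ 3 by norm_num, Real.log_pow]
    push_cast
    ring
  have b := Real.log_le_sub_one_of_pos (x := 8 / (1 + √2) ^ 2) (by positivity)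
  have b' : 8 / (1 + √2) ^ 2 < 1.376 := by
    rw [div_lt_iff₀ (by positivity)]
    nlinarith
  have e3 : 2 / √2 = √2 := by
    rw [div_eq_iff (by linarith)]
    nlinarith
  have e4 : Real.log (√2) = Real.log 2 / 2 := Real.log_sqrt (by norm_num)
  have hprod : √2 * Real.log 2 < 1.4143 * 0.6931471808 :=
    mul_lt_mul'' hs2 l2 hs0 (by linarith)
  rw [F2, Real.log_abs, e1, e3, e4]
  linarith

theorem F2_neg {x : ℝ} (hx : 21 / 25 ≤ x) (hx2 : x ≤ √2) : F2 x < 0 := by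
  rcases le_or_gt x 1 with h1 | h1
  · have h0 : 0 < x := by linarith
    have b1 : x * Real.log x ≤ x * (x - 1) :=
      mul_le_mul_of_nonneg_left (Real.log_le_sub_one_of_pos h0) h0.le
    have b2 : (1 - x) * Real.log (1 - x) ≤ 0 :=
      mul_nonpos_of_nonneg_of_nonpos (by linarith)
        (Real.log_nonpos (by linarith) (by linarith))
    have b3 : 0.6 ≤ Real.log (1 + x) := by
      have e : Real.log (1 + x) = Real.log 2 - Real.log (2 / (1 + x)) := by
        rw [Real.log_div (by norm_num) (by linarith)]
        ring
      have h := Real.log_le_sub_one_of_pos (x := 2 / (1 + x)) (by positivity)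
      have h' : 2 / (1 + x) < 1.09 := by
        rw [div_lt_iff₀ (by positivity)]
        linarith
      have := Real.log_two_gt_d9
      linarith
    have b4 : (1 + x) * 0.6 ≤ (1 + x) * Real.log (1 + x) :=
      mul_le_mul_of_nonneg_left b3 (by linarith)
    have b5 : 2 / x ≤ 2 + 2.4 * (1 - x) := by
      rw [div_le_iff₀ h0]
      nlinarith
    rw [F2, Real.log_abs]
    nlinarith
  · exact (strictMonoOn_F2.monotoneOn h1.le (h1.le.trans hx2) hx2).trans_lt F2_sqrt_two_neg

theorem F2_ne_of_lt {a b : ℝ} (ha : 0 < a) (hab : a < b) (hsum : a + b ≤ √2) : F2 a ≠ F2 b := by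
  have hs2 : √2 < 1.4143 := (Real.sqrt_lt' (by norm_num)).2 (by norm_num)
  rcases le_or_gt b (21 / 25) with hb | hb
  · exact (strictAntiOn_F2 ⟨ha, hab.le.trans hb⟩ ⟨ha.trans hab, hb⟩ hab).ne'
  · have h1 : F2 (23 / 40) < F2 a :=
      strictAntiOn_F2 ⟨ha, by linarith⟩ ⟨by norm_num, by norm_num⟩ (by linarith)
    have h2 : F2 b < 0 := F2_neg hb.le (by linarith)
    exact (h2.trans (F2_pos.trans h1)).ne'

theorem F2_stationary_implies_equal (n : ℕ) (hn : 2 ≤ n) (β : Fin n → ℝ)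
    (hβ : ∀ k, β k ∈ Set.Ioo (0 : ℝ) (Real.sqrt 2)) (hsum : ∑ k, β k = Real.sqrt 2)
    (hstat : ∀ i j, F2 (β i) = F2 (β j)) :
    ∀ k, β k = Real.sqrt 2 / n := by
  have hpair : ∀ i j, i ≠ j → β i + β j ≤ √2 := fun i j hij => by
    rw [← hsum, ← Finset.sum_pair hij]
    exact Finset.sum_le_sum_of_subset_of_nonneg (Finset.subset_univ _)
      fun k _ _ => (hβ k).1.le
  have hle : ∀ i j, β j ≤ β i := fun i j => by
    by_contra! h
    exact F2_ne_of_lt (hβ i).1 h (hpair i j fun e => by simp [e] at h) (hstat i j)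
  intro k
  have hconst : ∑ j, β j = n * β k := by
    rw [Finset.sum_congr rfl fun j _ => le_antisymm (hle k j) (hle j k)]
    simp
  rw [eq_div_iff (by positivity), ← hsum, hconst, mul_comm]
end

section
/- Let n ≥ 2 be a natural number. The point (√2/n, …, √2/n) is the unique maximizer of the product ∏_{k=1}^n Ψ₂(βₖ) over the set {(β₁,…,βₙ) : βₖ ∈ (0,√2) for all k, β₁ + ⋯ + βₙ = √2}; that is, if βₖ ∈ (0,√2) for all k, ∑βₖ = √2 and ∏_{k=1}^n Ψ₂(βₖ) = (Ψ₂(√2/n))^n, then βₖ = √2/n for every k. -/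
open Real

/-- Ψ₂(β) = 8 · β^(2β²+2) · |1−β|^(−(1−β)²) · (1+β)^(−(1+β)²) for β ≠ 1, Ψ₂(1) = 1/2. -/
noncomputable def Psi2 (β : ℝ) : ℝ :=
  if β = 1 then 1 / 2
  else 8 * β ^ (2 * β ^ 2 + 2) * |1 - β| ^ (-((1 - β) ^ 2)) * (1 + β) ^ (-((1 + β) ^ 2))

/-- The logarithm of `Psi2` on the positive reals. -/
noncomputable def logPsi2 (x : ℝ) : ℝ :=
  log 8 + (2 * x ^ 2 + 2) * log x - (1 - x) ^ 2 * log (1 - x) - (1 + x) ^ 2 * log (1 + x)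

/-- Half the derivative of `logPsi2`. -/
noncomputable def halfDerivLogPsi2 (x : ℝ) : ℝ :=
  2 * (x * log x) + x⁻¹ + (1 - x) * log (1 - x) - (1 + x) * log (1 + x)

theorem Psi2_eq_exp {x : ℝ} (hx : 0 < x) : Psi2 x = exp (logPsi2 x) := by
  unfold Psi2 logPsi2
  split_ifs with h
  · subst h
    have h8 : log 8 = 3 * log 2 := by
      rw [show (8 : ℝ) = 2 ^ (3 : ℕ) by norm_num, log_pow]
      norm_num
    have : log 8 + (2 * 1 ^ 2 + 2) * log 1 - (1 - 1) ^ 2 * log (1 - 1)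
        - (1 + 1) ^ 2 * log (1 + 1) = -log (2 : ℝ) := by
      rw [h8, log_one, show (1 : ℝ) + 1 = 2 by norm_num]
      ring
    rw [this, exp_neg, exp_log (by norm_num)]
    norm_num
  · have h1 : 0 < |1 - x| := abs_pos.mpr (sub_ne_zero.mpr (Ne.symm h))
    rw [rpow_def_of_pos hx, rpow_def_of_pos h1, rpow_def_of_pos (by linarith : 0 < 1 + x),
      log_abs, ← exp_log (by norm_num : (0 : ℝ) < 8), log_exp, ← exp_add, ← exp_add, ← exp_add]
    ring_nf

theorem hasDerivAt_sq_mul_log (t : ℝ) :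
    HasDerivAt (fun t : ℝ => t ^ 2 * log t) (2 * (t * log t) + t) t := by
  rcases eq_or_ne t 0 with rfl | ht
  · rw [hasDerivAt_iff_tendsto_slope]
    have h := (continuous_mul_log.tendsto 0).mono_left
      (nhdsWithin_le_nhds (s := {(0 : ℝ)}ᶜ))
    simp only [zero_mul, mul_zero, add_zero] at h ⊢
    refine h.congr' ?_
    filter_upwards [self_mem_nhdsWithin] with x hx
    have hx : x ≠ 0 := hx
    simp only [slope_def_field]
    field_simp
    simp [pow_two, mul_right_comm]
  · refine ((hasDerivAt_pow 2 t).mul (hasDerivAt_log ht)).congr_deriv ?_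
    field_simp
    push_cast
    ring

theorem hasDerivAt_logPsi2 {x : ℝ} (hx : 0 < x) :
    HasDerivAt logPsi2 (2 * halfDerivLogPsi2 x) x := by
  have h1 := (hasDerivAt_sq_mul_log (1 - x)).comp x ((hasDerivAt_id x).const_sub 1)
  have h2 := (hasDerivAt_sq_mul_log (1 + x)).comp x ((hasDerivAt_id x).const_add 1)
  have h3 := (hasDerivAt_sq_mul_log x).const_mul 2
  have h4 := (hasDerivAt_log hx.ne').const_mul 2
  refine (((((h3.add h4).const_add (log 8)).sub h1).sub h2).congr_of_eventuallyEq
    (.of_forall fun y => ?_)).congr_deriv ?_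
  · simp [logPsi2]
    ring
  · simp only [halfDerivLogPsi2]
    ring

theorem continuousOn_halfDerivLogPsi2 : ContinuousOn halfDerivLogPsi2 (Set.Ioi 0) := by
  unfold halfDerivLogPsi2
  have h1 : Continuous fun x : ℝ => (1 - x) * log (1 - x) :=
    continuous_mul_log.comp (continuous_const.sub continuous_id)
  have h2 : Continuous fun x : ℝ => (1 + x) * log (1 + x) :=
    continuous_mul_log.comp (continuous_const.add continuous_id)
  exact (((continuous_mul_log.const_mul 2).continuousOn.add
    (continuousOn_inv₀.mono fun x hx => ne_of_gt hx)).add h1.continuousOn).sub h2.continuousOn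

theorem hasDerivAt_halfDerivLogPsi2 {x : ℝ} (hx : 0 < x) (hx1 : x ≠ 1) :
    HasDerivAt halfDerivLogPsi2 (2 * log x - (x ^ 2)⁻¹ - log (1 - x) - log (1 + x)) x := by
  have h1 := (hasDerivAt_mul_log (sub_ne_zero.mpr hx1.symm)).comp x
    ((hasDerivAt_id x).const_sub 1)
  have h2 := (hasDerivAt_mul_log (by linarith : 1 + x ≠ 0)).comp x
    ((hasDerivAt_id x).const_add 1)
  refine ((((hasDerivAt_mul_log hx.ne').const_mul 2).add
    (hasDerivAt_inv hx.ne')).add h1).sub h2 |>.congr_deriv ?_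
  ring

theorem halfDerivLogPsi2_strictAntiOn :
    StrictAntiOn halfDerivLogPsi2 (Set.Ioc 0 (7 / 8)) := by
  refine strictAntiOn_of_deriv_neg (convex_Ioc _ _)
    (continuousOn_halfDerivLogPsi2.mono fun x hx => hx.1) fun x hx => ?_
  rw [interior_Ioc] at hx
  obtain ⟨h0, h1⟩ := hx
  rw [(hasDerivAt_halfDerivLogPsi2 h0 (by linarith)).deriv]
  have hs : x ^ 2 < 49 / 64 := by nlinarith
  have hs0 : 0 < x ^ 2 := by positivity
  have hlog : 2 * log x - log (1 - x) - log (1 + x) = log (x ^ 2 / (1 - x ^ 2)) := by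
    rw [log_div hs0.ne' (by linarith), show 1 - x ^ 2 = (1 - x) * (1 + x) by ring,
      log_mul (by linarith) (by linarith), log_pow]
    push_cast
    ring
  have hle : log (x ^ 2 / (1 - x ^ 2)) ≤ log (49 / 15) := by
    apply log_le_log (div_pos hs0 (by linarith))
    rw [div_le_div_iff₀ (by linarith) (by norm_num)]
    linarith
  have hnum : log (49 / 15 : ℝ) < 64 / 49 := by
    have h2 : log (49 / 15 : ℝ) = 2 * log 2 + log (49 / 60) := by
      rw [show (49 / 15 : ℝ) = 2 ^ 2 * (49 / 60) by norm_num,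
        log_mul (by norm_num) (by norm_num), log_pow]
      norm_num
    have := log_le_sub_one_of_pos (by norm_num : (0 : ℝ) < 49 / 60)
    have := log_two_lt_d9
    linarith
  have hinv : 64 / 49 < (x ^ 2)⁻¹ := by
    rw [lt_inv_comm₀ (by norm_num) hs0]
    linarith
  linarith

theorem halfDerivLogPsi2_strictMonoOn :
    StrictMonoOn halfDerivLogPsi2 (Set.Icc 1 (√2)) := by
  refine strictMonoOn_of_deriv_pos (convex_Icc _ _)
    (continuousOn_halfDerivLogPsi2.mono fun x hx => lt_of_lt_of_le one_pos hx.1) fun x hx => ?_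
  rw [interior_Icc] at hx
  have h1 : 1 < x := hx.1
  rw [(hasDerivAt_halfDerivLogPsi2 (by linarith) h1.ne').deriv]
  have hlog : log (1 - x) + log (1 + x) = log (x ^ 2 - 1) := by
    rw [← log_neg_eq_log (1 - x), ← log_mul (by linarith) (by linarith)]
    ring_nf
  have hfac : log (x ^ 2 - 1) = 2 * log x + log (1 - (x ^ 2)⁻¹) := by
    have hinv : (x ^ 2)⁻¹ < 1 := inv_lt_one_of_one_lt₀ (by nlinarith)
    have hsq : 2 * log x = log (x ^ 2) := by simp
    rw [hsq, ← log_mul (by positivity) (by linarith), mul_sub,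
      mul_inv_cancel₀ (by positivity), mul_one]
  have hinv : 0 < (x ^ 2)⁻¹ := by positivity
  have hlt := log_lt_sub_one_of_pos
    (sub_pos.mpr (inv_lt_one_of_one_lt₀ (by nlinarith : 1 < x ^ 2))) (by linarith)
  linarith

theorem halfDerivLogPsi2_neg {x : ℝ} (h0 : 7 / 8 ≤ x) (h1 : x ≤ √2) :
    halfDerivLogPsi2 x < 0 := by
  have hl2 := log_two_gt_d9
  have hu2 := log_two_lt_d9
  rcases le_total x 1 with hx | hx
  · unfold halfDerivLogPsi2
    have e1 : x * log x ≤ 0 :=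
      mul_nonpos_of_nonneg_of_nonpos (by linarith) (log_nonpos (by linarith) hx)
    have e2 : (1 - x) * log (1 - x) ≤ 0 :=
      mul_nonpos_of_nonneg_of_nonpos (by linarith) (log_nonpos (by linarith) (by linarith))
    have e3 : x⁻¹ ≤ 8 / 7 := by
      rw [inv_le_comm₀ (by linarith) (by norm_num)]
      linarith
    have e4 : log 2 - 1 / 15 ≤ log (1 + x) := by
      have h := one_sub_inv_le_log_of_pos (by linarith : 0 < (1 + x) / 2)
      rw [log_div (by linarith) (by norm_num)] at h
      have : ((1 + x) / 2)⁻¹ ≤ 16 / 15 := by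
        rw [inv_le_comm₀ (by linarith) (by norm_num)]
        linarith
      linarith
    nlinarith
  · have hle : halfDerivLogPsi2 x ≤ halfDerivLogPsi2 (√2) :=
      halfDerivLogPsi2_strictMonoOn.monotoneOn ⟨hx, h1⟩ ⟨hx.trans h1, le_rfl⟩ h1
    refine hle.trans_lt ?_
    have hs : √2 ^ 2 = 2 := sq_sqrt (by norm_num)
    have hs1 : √2 < 1.4143 := by
      rw [sqrt_lt' (by norm_num)]
      norm_num
    have hs2 : 1.414 < √2 := lt_sqrt_of_sq_lt (by norm_num)
    have hlog : log (1 - √2) = -log (1 + √2) := by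
      rw [← log_inv, ← log_neg_eq_log (1 - √2)]
      congr 1
      apply eq_inv_of_mul_eq_one_left
      linarith
    have hinv : (√2)⁻¹ = √2 / 2 := by
      rw [inv_eq_iff_eq_inv, inv_div, eq_div_iff (by linarith)]
      linarith
    have hlow : log 2 + 1 / 6 ≤ log (1 + √2) := by
      have h := one_sub_inv_le_log_of_pos (by linarith : 0 < (1 + √2) / 2)
      rw [log_div (by linarith) (by norm_num)] at h
      have : ((1 + √2) / 2)⁻¹ ≤ 5 / 6 := by
        rw [inv_le_comm₀ (by linarith) (by norm_num)]
        linarith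
      linarith
    have hsqrt : log (√2) = log 2 / 2 := log_sqrt (by norm_num)
    unfold halfDerivLogPsi2
    rw [hlog, hinv, hsqrt]
    nlinarith

theorem halfDerivLogPsi2_pos {x : ℝ} (h0 : 0 < x) (h1 : x ≤ 27 / 50) :
    0 < halfDerivLogPsi2 x := by
  have hle : halfDerivLogPsi2 (27 / 50) ≤ halfDerivLogPsi2 x :=
    halfDerivLogPsi2_strictAntiOn.antitoneOn ⟨h0, by linarith⟩ ⟨by norm_num, by norm_num⟩ h1
  refine lt_of_lt_of_le ?_ hle
  have hu2 := log_two_lt_d9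
  have e1 := one_sub_inv_le_log_of_pos (by norm_num : (0 : ℝ) < 27 / 50 * 2)
  have e2 := one_sub_inv_le_log_of_pos (by norm_num : (0 : ℝ) < 23 / 50 * 2)
  have e3 := log_le_sub_one_of_pos (by norm_num : (0 : ℝ) < 77 / 50 / 2)
  rw [log_mul (by norm_num) (by norm_num)] at e1 e2
  rw [log_div (by norm_num) (by norm_num)] at e3
  unfold halfDerivLogPsi2
  norm_num at e1 e2 e3 ⊢
  linarith

theorem halfDerivLogPsi2_lt {x y : ℝ} (hx : 0 < x) (hxy : x < y) (hy : y ≤ √2)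
    (h : y ≤ 7 / 8 ∨ x ≤ 27 / 50) : halfDerivLogPsi2 y < halfDerivLogPsi2 x := by
  rcases le_total y (7 / 8) with h7 | h7
  · exact halfDerivLogPsi2_strictAntiOn ⟨hx, hxy.le.trans h7⟩ ⟨hx.trans hxy, h7⟩ hxy
  · rcases h with h | h
    · exact halfDerivLogPsi2_strictAntiOn ⟨hx, hxy.le.trans h⟩ ⟨hx.trans hxy, h⟩ hxy
    · exact (halfDerivLogPsi2_neg h7 hy).trans (halfDerivLogPsi2_pos hx h)

theorem logPsi2_lt_tangent {c x : ℝ} (hc : 0 < c) (hc' : c ≤ 27 / 50) (hx : 0 < x)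
    (hx' : x ≤ √2) (hne : x ≠ c) :
    logPsi2 x < logPsi2 c + 2 * halfDerivLogPsi2 c * (x - c) := by
  have hd : ∀ y, 0 < y → HasDerivAt (fun y => logPsi2 y - 2 * halfDerivLogPsi2 c * y)
      (2 * halfDerivLogPsi2 y - 2 * halfDerivLogPsi2 c) y := fun y hy => by
    refine ((hasDerivAt_logPsi2 hy).sub
      ((hasDerivAt_id y).const_mul (2 * halfDerivLogPsi2 c))).congr_deriv ?_
    ring
  rcases lt_or_gt_of_ne hne with h | h
  · have hmono : StrictMonoOn (fun y => logPsi2 y - 2 * halfDerivLogPsi2 c * y)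
        (Set.Icc x c) := by
      refine strictMonoOn_of_deriv_pos (convex_Icc _ _)
        (fun y hy => (hd y (hx.trans_le hy.1)).continuousAt.continuousWithinAt) fun y hy => ?_
      rw [interior_Icc] at hy
      have hy0 := hx.trans hy.1
      rw [(hd y hy0).deriv]
      have := halfDerivLogPsi2_lt hy0 hy.2
        (hc'.trans (le_sqrt_of_sq_le (by norm_num))) (.inl (by linarith))
      linarith
    have := hmono ⟨le_rfl, h.le⟩ ⟨h.le, le_rfl⟩ h
    simp only at this
    linarith
  · have hanti : StrictAntiOn (fun y => logPsi2 y - 2 * halfDerivLogPsi2 c * y)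
        (Set.Icc c x) := by
      refine strictAntiOn_of_deriv_neg (convex_Icc _ _)
        (fun y hy => (hd y (hc.trans_le hy.1)).continuousAt.continuousWithinAt) fun y hy => ?_
      rw [interior_Icc] at hy
      rw [(hd y (hc.trans hy.1)).deriv]
      have := halfDerivLogPsi2_lt hc hy.1 (hy.2.le.trans hx') (.inr hc')
      linarith
    have := hanti ⟨le_rfl, h.le⟩ ⟨h.le, le_rfl⟩ h
    simp only at this
    linarith

theorem logPsi2_add_lt {x y : ℝ} (hx : 0 < x) (hxy : x < y) (hsum : x + y = √2) :
    logPsi2 x + logPsi2 y < 2 * logPsi2 (√2 / 2) := by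
  have hs1 : √2 < 1.415 := by
    rw [sqrt_lt' (by norm_num)]
    norm_num
  have hd : ∀ t, 0 < t → t < √2 → HasDerivAt (fun t => logPsi2 t + logPsi2 (√2 - t))
      (2 * halfDerivLogPsi2 t - 2 * halfDerivLogPsi2 (√2 - t)) t := fun t h0 h1 => by
    refine ((hasDerivAt_logPsi2 h0).add ((hasDerivAt_logPsi2 (sub_pos.mpr h1)).comp t
      ((hasDerivAt_id t).const_sub (√2)))).congr_deriv ?_
    ring
  have hmono : StrictMonoOn (fun t => logPsi2 t + logPsi2 (√2 - t)) (Set.Icc x (√2 / 2)) := by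
    refine strictMonoOn_of_deriv_pos (convex_Icc _ _) (fun t ht =>
      (hd t (hx.trans_le ht.1) (by linarith [ht.2])).continuousAt.continuousWithinAt) fun t ht => ?_
    rw [interior_Icc] at ht
    obtain ⟨h1, h2⟩ := ht
    rw [(hd t (by linarith) (by linarith)).deriv]
    have := halfDerivLogPsi2_lt (by linarith : 0 < t) (by linarith : t < √2 - t) (by linarith)
      ((le_total (√2 - t) (7 / 8)).imp_right fun h => by linarith)
    linarith
  have := hmono ⟨le_rfl, by linarith⟩ ⟨by linarith, le_rfl⟩ (by linarith : x < √2 / 2)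
  simp only [sub_half] at this
  rw [show √2 - x = y by linarith] at this
  linarith

theorem psi2_unique_maximizer (n : ℕ) (hn : 2 ≤ n) (β : Fin n → ℝ)
    (hβ : ∀ k, β k ∈ Set.Ioo (0 : ℝ) (Real.sqrt 2)) (hsum : ∑ k, β k = Real.sqrt 2)
    (hmax : ∏ k, Psi2 (β k) = (Psi2 (Real.sqrt 2 / n)) ^ n) :
    ∀ k, β k = Real.sqrt 2 / n := by
  have hpos : 0 < Real.sqrt 2 := Real.sqrt_pos.mpr two_pos
  have hn0 : (0 : ℝ) < n := by exact_mod_cast (by omega : 0 < n)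
  have hlog : ∑ k, logPsi2 (β k) = n * logPsi2 (√2 / n) := by
    rw [Finset.prod_congr rfl fun k _ => Psi2_eq_exp (hβ k).1, Psi2_eq_exp (div_pos hpos hn0),
      ← exp_sum, ← exp_nat_mul] at hmax
    exact exp_injective hmax
  rcases hn.eq_or_lt with rfl | hn3
  · simp only [Fin.sum_univ_two, Nat.cast_ofNat] at hsum hlog ⊢
    have h01 : β 0 = β 1 := by
      rcases lt_trichotomy (β 0) (β 1) with h | h | h
      · exact absurd hlog (logPsi2_add_lt (hβ 0).1 h hsum).ne
      · exact h
      · rw [add_comm] at hsum hlog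
        exact absurd hlog (logPsi2_add_lt (hβ 1).1 h hsum).ne
    rw [Fin.forall_fin_two]
    constructor <;> linarith
  · by_contra! hk
    obtain ⟨k, hk⟩ := hk
    have hc : √2 / n ≤ 27 / 50 := by
      have h3 : (3 : ℝ) ≤ n := by exact_mod_cast hn3
      have hs : √2 < 1.5 := by
        rw [sqrt_lt' (by norm_num)]
        norm_num
      rw [div_le_iff₀ hn0]
      linarith
    have hlt : ∑ k, logPsi2 (β k) <
        ∑ k, (logPsi2 (√2 / n) + 2 * halfDerivLogPsi2 (√2 / n) * (β k - √2 / n)) := by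
      refine Finset.sum_lt_sum (fun i _ => ?_) ⟨k, Finset.mem_univ k,
        logPsi2_lt_tangent (div_pos hpos hn0) hc (hβ k).1 (hβ k).2.le hk⟩
      rcases eq_or_ne (β i) (√2 / n) with h | h
      · simp [h]
      · exact (logPsi2_lt_tangent (div_pos hpos hn0) hc (hβ i).1 (hβ i).2.le h).le
    rw [Finset.sum_add_distrib, ← Finset.mul_sum, Finset.sum_sub_distrib, hsum] at hlt
    simp only [Finset.sum_const, Finset.card_univ, Fintype.card_fin, nsmul_eq_mul,
      mul_div_cancel₀ _ hn0.ne', sub_self, mul_zero, add_zero] at hlt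
    exact absurd hlog hlt.ne
end
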